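/- arXiv:1805.00670 — 2 statements merged into one kernel-verified Lean document; each statement's English description precedes it below -/
import Mathlib

section
/- Jordan's Lemma: Let P and Q be orthogonal projections on a finite-dimensional complex inner product space V. Then there exists a finite family (V_i)_{i∈I} of pairwise-orthogonal subspaces of V whose internal orthogonal direct sum is all of V, such that each V_i is invariant under both P and Q (i.e., P(V_i) ⊆ V_i and Q(V_i) ⊆ V_i), each V_i has dimension 1 or 2, and for every i with dim V_i = 2 the restrictions of P and of Q to V_i each have rank exactly one. -/
open scoped ComplexInnerProductSpace

/-- A block of a pair `P`, `Q`: an invariant subspace of dimension 1 or 2, on which `P` and `Q`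
have rank one if the dimension is 2. -/
structure IsJordanBlock {K V : Type*} [Field K] [AddCommGroup V] [Module K V]
    (P Q : V →ₗ[K] V) (W : Submodule K V) : Prop where
  map_left_le : W.map P ≤ W
  map_right_le : W.map Q ≤ W
  finrank_eq : Module.finrank K W = 1 ∨ Module.finrank K W = 2
  finrank_map : Module.finrank K W = 2 →
    Module.finrank K (W.map P) = 1 ∧ Module.finrank K (W.map Q) = 1

/-- An endomorphism has an eigenvector in every nonzero invariant subspace. -/
theorem LinearMap.exists_eigenvector_mem {K V : Type*} [Field K] [IsAlgClosed K]
    [AddCommGroup V] [Module K V] [FiniteDimensional K V] (f : V →ₗ[K] V)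
    {U : Submodule K V} (hU : U ≠ ⊥) (hf : ∀ x ∈ U, f x ∈ U) :
    ∃ v ∈ U, v ≠ 0 ∧ ∃ μ : K, f v = μ • v := by
  have := Submodule.nontrivial_iff_ne_bot.mpr hU
  obtain ⟨μ, hμ⟩ := Module.End.exists_eigenvalue (f.restrict hf)
  obtain ⟨v, hv⟩ := hμ.exists_hasEigenvector
  refine ⟨v, v.2, fun h => hv.2 (Subtype.ext h), μ, ?_⟩
  simpa using congrArg Subtype.val hv.apply_eq_smul

/-- Two idempotents on a finite-dimensional space over an algebraically closed field have a block
in every nonzero subspace that is invariant under both. -/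
theorem exists_isJordanBlock_le {K V : Type*} [Field K] [IsAlgClosed K]
    [AddCommGroup V] [Module K V] [FiniteDimensional K V] {P Q : V →ₗ[K] V}
    (hP : ∀ x, P (P x) = P x) (hQ : ∀ x, Q (Q x) = Q x) {U : Submodule K V} (hU : U ≠ ⊥)
    (hUP : ∀ x ∈ U, P x ∈ U) (hUQ : ∀ x ∈ U, Q x ∈ U) :
    ∃ W ≤ U, IsJordanBlock P Q W := by
  by_cases h : U.map P = ⊥
  · obtain ⟨v, hvU, hv, μ, hμ⟩ := Q.exists_eigenvector_mem hU hUQ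
    have hPv : P v = 0 := by
      have : P v ∈ U.map P := Submodule.mem_map_of_mem hvU
      simpa [h] using this
    have h1 : Module.finrank K (K ∙ v) = 1 := finrank_span_singleton hv
    refine ⟨K ∙ v, by simpa using hvU, ?_, ?_, .inl h1, by simp [h1]⟩
    · simp [Submodule.map_span, hPv]
    · rw [Submodule.map_span, Set.image_singleton, hμ]
      exact Submodule.span_singleton_smul_le K μ v
  · have hmem : ∀ x ∈ U.map P, (P ∘ₗ Q) x ∈ U.map P := by
      rintro _ ⟨x, hx, rfl⟩
      exact Submodule.mem_map_of_mem (hUQ _ (hUP x hx))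
    obtain ⟨v, ⟨u, hu, rfl⟩, hv, μ, hμ⟩ := (P ∘ₗ Q).exists_eigenvector_mem h hmem
    have hvU : P u ∈ U := hUP u hu
    have hPv : P (P u) = P u := hP u
    generalize P u = v at *
    rw [LinearMap.comp_apply] at hμ
    have hmapP : (Submodule.span K {v, Q v}).map P = K ∙ v := by
      rw [Submodule.map_span, Set.image_pair, hPv, hμ, Submodule.span_insert]
      exact sup_eq_left.mpr (Submodule.span_singleton_smul_le K μ v)
    have hmapQ : (Submodule.span K {v, Q v}).map Q = K ∙ Q v := by
      rw [Submodule.map_span, Set.image_pair, hQ, Set.pair_eq_singleton]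
    have hle : Module.finrank K (Submodule.span K {v, Q v}) ≤ 2 := by
      classical
      have := finrank_span_finset_le_card (R := K) ({v, Q v} : Finset V)
      rw [Set.finrank, Finset.coe_pair] at this
      exact this.trans Finset.card_le_two
    have hpos : 1 ≤ Module.finrank K (Submodule.span K {v, Q v}) := by
      rw [← finrank_span_singleton (K := K) hv]
      exact Submodule.finrank_mono (Submodule.span_mono (by simp))
    refine ⟨Submodule.span K {v, Q v}, ?_, ?_, ?_, by omega, fun h2 => ?_⟩
    · rw [Submodule.span_le, Set.pair_subset_iff]
      exact ⟨hvU, hUQ v hvU⟩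
    · rw [hmapP]
      exact Submodule.span_mono (by simp)
    · rw [hmapQ]
      exact Submodule.span_mono (by simp)
    · rw [hmapP, hmapQ]
      refine ⟨finrank_span_singleton hv, finrank_span_singleton fun h0 => ?_⟩
      rw [h0, Set.pair_comm, Submodule.span_insert_zero, finrank_span_singleton hv] at h2
      omega

/-- Every subspace invariant under two orthogonal projections is a finite orthogonal sum of
blocks. -/
theorem exists_orthogonal_isJordanBlock {V : Type*} [NormedAddCommGroup V]
    [InnerProductSpace ℂ V] [FiniteDimensional ℂ V] {P Q : V →ₗ[ℂ] V}
    (hP : ∀ x, P (P x) = P x) (hPsa : P.IsSymmetric)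
    (hQ : ∀ x, Q (Q x) = Q x) (hQsa : Q.IsSymmetric) (U : Submodule ℂ V)
    (hUP : ∀ x ∈ U, P x ∈ U) (hUQ : ∀ x ∈ U, Q x ∈ U) :
    ∃ (I : Type) (_ : Fintype I) (W : I → Submodule ℂ V),
      (Pairwise fun i j => W i ⟂ W j) ∧ (⨆ i, W i) = U ∧ ∀ i, IsJordanBlock P Q (W i) := by
  induction U using WellFoundedLT.induction with
  | ind U ih =>
  by_cases hU : U = ⊥
  · exact ⟨Empty, inferInstance, Empty.elim, fun i => i.elim, by simp [hU], fun i => i.elim⟩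
  obtain ⟨B, hBU, hB⟩ := exists_isJordanBlock_le hP hQ hU hUP hUQ
  have hsup : B ⊔ Bᗮ ⊓ U = U := Submodule.sup_orthogonal_inf_of_hasOrthogonalProjection hBU
  have hinv : ∀ {f : V →ₗ[ℂ] V}, f.IsSymmetric → B.map f ≤ B → (∀ x ∈ U, f x ∈ U) →
      ∀ x ∈ Bᗮ ⊓ U, f x ∈ Bᗮ ⊓ U := fun {f} hf hfB hfU x hx =>
    ⟨(Submodule.mem_orthogonal _ _).mpr fun y hy => by
      rw [← hf y x]
      exact (Submodule.mem_orthogonal _ _).mp hx.1 _ (hfB (Submodule.mem_map_of_mem hy)),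
      hfU x hx.2⟩
  have hlt : Bᗮ ⊓ U < U := by
    refine lt_of_le_of_ne inf_le_right fun h => ?_
    have hbot : B = ⊥ := by
      rw [eq_bot_iff, ← B.inf_orthogonal_eq_bot]
      exact le_inf le_rfl (hBU.trans (inf_eq_right.mp h))
    have h0 : Module.finrank ℂ B = 0 := by rw [hbot, finrank_bot]
    have := hB.finrank_eq
    omega
  obtain ⟨I, _, W, hW, hWsup, hWB⟩ := ih _ hlt (hinv hPsa hB.map_left_le hUP)
    (hinv hQsa hB.map_right_le hUQ)
  have hBW : ∀ i, B ⟂ W i := fun i => by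
    have : W i ≤ Bᗮ := (le_iSup W i).trans (hWsup.le.trans inf_le_left)
    exact (Submodule.isOrtho_iff_le.mpr this).symm
  refine ⟨Option I, inferInstance, fun o => o.elim B W, ?_, ?_, ?_⟩
  · rintro (_ | i) (_ | j) hij
    · exact absurd rfl hij
    · exact hBW j
    · exact (hBW i).symm
    · exact hW fun h => hij (congrArg some h)
  · rw [iSup_option]
    simpa [hWsup] using hsup
  · rintro (_ | i)
    · exact hB
    · exact hWB i

/-- **Jordan's Lemma.** For two orthogonal projections `P`, `Q` on a finite-dimensional
complex inner product space `V`, there is a finite family of pairwise-orthogonal subspaces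
whose (orthogonal) direct sum is all of `V`, each invariant under both `P` and `Q`,
each of dimension 1 or 2, and on each two-dimensional block the restrictions of `P` and `Q`
have rank exactly one. -/
theorem jordan_lemma {V : Type*} [NormedAddCommGroup V] [InnerProductSpace ℂ V]
    [FiniteDimensional ℂ V]
    (P Q : V →ₗ[ℂ] V)
    (hPidem : P ∘ₗ P = P) (hPsa : ∀ x y : V, ⟪P x, y⟫ = ⟪x, P y⟫)
    (hQidem : Q ∘ₗ Q = Q) (hQsa : ∀ x y : V, ⟪Q x, y⟫ = ⟪x, Q y⟫) :
    ∃ (I : Type) (_ : Fintype I) (W : I → Submodule ℂ V),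
      (∀ i j : I, i ≠ j → ∀ x ∈ W i, ∀ y ∈ W j, ⟪x, y⟫ = 0) ∧
      (⨆ i, W i) = ⊤ ∧
      (∀ i, Submodule.map P (W i) ≤ W i) ∧
      (∀ i, Submodule.map Q (W i) ≤ W i) ∧
      (∀ i, Module.finrank ℂ (W i) = 1 ∨ Module.finrank ℂ (W i) = 2) ∧
      (∀ i, Module.finrank ℂ (W i) = 2 →
        Module.finrank ℂ (Submodule.map P (W i)) = 1 ∧
        Module.finrank ℂ (Submodule.map Q (W i)) = 1) := by
  obtain ⟨I, hI, W, hW, hsup, hB⟩ := exists_orthogonal_isJordanBlock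
    (LinearMap.congr_fun hPidem) hPsa (LinearMap.congr_fun hQidem) hQsa ⊤
    (fun _ _ => Submodule.mem_top) (fun _ _ => Submodule.mem_top)
  exact ⟨I, hI, W, fun i j hij x hx y hy => (hW hij).inner_eq hx hy, hsup,
    fun i => (hB i).map_left_le, fun i => (hB i).map_right_le, fun i => (hB i).finrank_eq,
    fun i => (hB i).finrank_map⟩
end

section
/- Two-dimensional invariant blocks generated by an eigenbasis: Let Π₀ and Π₁ be orthogonal projections on a finite-dimensional complex inner product space V, and let (ψ_i)_{i∈I} be an orthonormal basis of the range of Π₀ such that ⟨ψ_i, Π₁ ψ_j⟩ = 0 for all i ≠ j and such that p_i := ⟨ψ_i, Π₁ ψ_i⟩ lies in the open interval (0, 1) for each i. With φ_i = p_i^{−1/2} Π₁ ψ_i and φ'_i = (1 − p_i)^{−1/2} (ψ_i − Π₁ ψ_i), define ψ'_i = √(1 − p_i)·φ_i − √(p_i)·φ'_i. Then Π₀ ψ'_i = 0 for every i ∈ I, and for each i the two-dimensional subspace span{ψ_i, ψ'_i} is invariant under both Π₀ and Π₁. -/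
open scoped ComplexInnerProductSpace

/-- A symmetric linear map kills every vector orthogonal to a spanning set of its range. -/
theorem symmetric_apply_eq_zero_of_orthogonal {V : Type*} [NormedAddCommGroup V]
    [InnerProductSpace ℂ V] {T : V →ₗ[ℂ] V} (hT : ∀ x y : V, ⟪T x, y⟫ = ⟪x, T y⟫)
    {s : Set V} (hs : Submodule.span ℂ s = LinearMap.range T) {w : V}
    (hw : ∀ u ∈ s, ⟪u, w⟫ = 0) : T w = 0 := by
  have hspan : ∀ u ∈ Submodule.span ℂ s, ⟪u, w⟫ = 0 := fun u hu => by
    induction hu using Submodule.span_induction with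
    | mem u hu => exact hw u hu
    | zero => exact inner_zero_left w
    | add x y _ _ hx hy => rw [inner_add_left, hx, hy, add_zero]
    | smul c x _ hx => rw [inner_smul_left, hx, mul_zero]
  rw [← inner_self_eq_zero (𝕜 := ℂ), ← hT]
  exact hspan _ (hs ▸ LinearMap.mem_range_self T (T w))

/-- The span of two vectors is invariant under a linear map sending both of them into it. -/
theorem map_span_pair_le {V : Type*} [AddCommGroup V] [Module ℂ V] {T : V →ₗ[ℂ] V} {x y : V}
    (hx : T x ∈ Submodule.span ℂ {x, y}) (hy : T y ∈ Submodule.span ℂ {x, y}) :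
    Submodule.map T (Submodule.span ℂ {x, y}) ≤ Submodule.span ℂ {x, y} := by
  rw [Submodule.map_span_le]
  rintro v (rfl | rfl)
  exacts [hx, hy]

/-- **Two-dimensional invariant blocks generated by an eigenbasis.** Let `P0 = Π₀`, `P1 = Π₁`
be orthogonal projections, `ψ` an orthonormal basis of the range of `Π₀` with
`⟪ψ i, Π₁ ψ j⟫ = 0` for `i ≠ j` and `p i = ⟪ψ i, Π₁ ψ i⟫ ∈ (0, 1)`. With
`φ i = p i^{-1/2} Π₁ ψ i`, `φ' i = (1 − p i)^{-1/2} (ψ i − Π₁ ψ i)` and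
`ψ' i = √(1 − p i) φ i − √(p i) φ' i`, one has `Π₀ ψ' i = 0`, and each two-dimensional
subspace `span {ψ i, ψ' i}` is invariant under both `Π₀` and `Π₁`. -/
theorem eigenbasis_two_dim_blocks {V : Type*} [NormedAddCommGroup V]
    [InnerProductSpace ℂ V] [FiniteDimensional ℂ V]
    (P0 P1 : V →ₗ[ℂ] V)
    (hP0idem : P0 ∘ₗ P0 = P0) (hP0sa : ∀ x y : V, ⟪P0 x, y⟫ = ⟪x, P0 y⟫)
    (hP1idem : P1 ∘ₗ P1 = P1) (hP1sa : ∀ x y : V, ⟪P1 x, y⟫ = ⟪x, P1 y⟫)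
    {I : Type} [Fintype I] (ψ : I → V) (hψon : Orthonormal ℂ ψ)
    (hψrange : ∀ i, ψ i ∈ LinearMap.range P0)
    (hψspan : Submodule.span ℂ (Set.range ψ) = LinearMap.range P0)
    (hoffdiag : ∀ i j : I, i ≠ j → ⟪ψ i, P1 (ψ j)⟫ = 0)
    (p : I → ℝ) (hp : ∀ i, ⟪ψ i, P1 (ψ i)⟫ = (p i : ℂ))
    (hp01 : ∀ i, p i ∈ Set.Ioo (0 : ℝ) 1)
    (φ φ' ψ' : I → V)
    (hφ : ∀ i, φ i = ((Real.sqrt (p i) : ℂ))⁻¹ • P1 (ψ i))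
    (hφ' : ∀ i, φ' i = ((Real.sqrt (1 - p i) : ℂ))⁻¹ • (ψ i - P1 (ψ i)))
    (hψ' : ∀ i, ψ' i = (Real.sqrt (1 - p i) : ℂ) • φ i - (Real.sqrt (p i) : ℂ) • φ' i) :
    (∀ i, P0 (ψ' i) = 0) ∧
    (∀ i, Submodule.map P0 (Submodule.span ℂ ({ψ i, ψ' i} : Set V))
            ≤ Submodule.span ℂ ({ψ i, ψ' i} : Set V) ∧
          Submodule.map P1 (Submodule.span ℂ ({ψ i, ψ' i} : Set V))
            ≤ Submodule.span ℂ ({ψ i, ψ' i} : Set V)) := by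
  have idem0 : ∀ x, P0 (P0 x) = P0 x := LinearMap.congr_fun hP0idem
  have idem1 : ∀ x, P1 (P1 x) = P1 x := LinearMap.congr_fun hP1idem
  have ha : ∀ i, (Real.sqrt (p i) : ℂ) ≠ 0 := fun i =>
    Complex.ofReal_ne_zero.2 (Real.sqrt_pos.2 (hp01 i).1).ne'
  have hb : ∀ i, (Real.sqrt (1 - p i) : ℂ) ≠ 0 := fun i =>
    Complex.ofReal_ne_zero.2 (Real.sqrt_pos.2 (sub_pos.2 (hp01 i).2)).ne'
  have ha2 : ∀ i, (Real.sqrt (p i) : ℂ) ^ 2 = p i := fun i => by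
    exact_mod_cast Real.sq_sqrt (hp01 i).1.le
  have hb2 : ∀ i, (Real.sqrt (1 - p i) : ℂ) ^ 2 = 1 - p i := fun i => by
    exact_mod_cast Real.sq_sqrt (sub_nonneg.2 (hp01 i).2.le)
  have hψ'_eq : ∀ i, ψ' i = ((Real.sqrt (p i) : ℂ) * Real.sqrt (1 - p i))⁻¹ •
      (P1 (ψ i) - (p i : ℂ) • ψ i) := fun i => by
    have := ha i
    have := hb i
    have := ha2 i
    have := hb2 i
    rw [hψ', hφ, hφ']
    match_scalars <;> field_simp <;> grind
  have hP1ψ : ∀ i, P1 (ψ i) =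
      (p i : ℂ) • ψ i + ((Real.sqrt (p i) : ℂ) * Real.sqrt (1 - p i)) • ψ' i := fun i => by
    rw [hψ'_eq, smul_inv_smul₀ (mul_ne_zero (ha i) (hb i)), add_sub_cancel]
  have hP0ψ' : ∀ i, P0 (ψ' i) = 0 := fun i => by
    refine symmetric_apply_eq_zero_of_orthogonal hP0sa hψspan ?_
    rintro _ ⟨j, rfl⟩
    rw [hψ'_eq, inner_smul_right, inner_sub_right, inner_smul_right]
    rcases eq_or_ne j i with rfl | hji
    · simp [hp, hψon.1 j, inner_self_eq_norm_sq_to_K]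
    · simp [hoffdiag j i hji, hψon.2 hji]
  refine ⟨hP0ψ', fun i => ?_⟩
  have mem_ψ : ψ i ∈ Submodule.span ℂ {ψ i, ψ' i} := Submodule.subset_span (by simp)
  have mem_ψ' : ψ' i ∈ Submodule.span ℂ {ψ i, ψ' i} := Submodule.subset_span (by simp)
  have mem_P1ψ : P1 (ψ i) ∈ Submodule.span ℂ {ψ i, ψ' i} := by
    rw [hP1ψ]
    exact add_mem (Submodule.smul_mem _ _ mem_ψ) (Submodule.smul_mem _ _ mem_ψ')
  refine ⟨map_span_pair_le ?_ ?_, map_span_pair_le mem_P1ψ ?_⟩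
  · obtain ⟨x, hx⟩ := hψrange i
    have : P0 (ψ i) = ψ i := by rw [← hx, idem0]
    rwa [this]
  · rw [hP0ψ']
    exact zero_mem _
  · have : P1 (ψ' i) ∈ Submodule.span ℂ {P1 (ψ i)} := by
      rw [hψ'_eq, map_smul, map_sub, map_smul, idem1]
      have := Submodule.mem_span_singleton_self (R := ℂ) (P1 (ψ i))
      exact Submodule.smul_mem _ _ (sub_mem this (Submodule.smul_mem _ _ this))
    exact (Submodule.span_singleton_le_iff_mem _ _).2 mem_P1ψ this
end
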